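/- arXiv:2508.13243 — 2 statements merged into one kernel-verified Lean document; each statement's English description precedes it below -/
import Mathlib

section
/- For all (x,ω),(y,ν) in ℝⁿ × S^{n-1}, the sub-Riemannian distance d((x,ω),(y,ν)) — defined as the infimum of lengths of piecewise Lipschitz curves γ in ℝⁿ × S^{n-1} joining the two points with ω(s)·dx(γ'(s)) = 0 almost everywhere — satisfies d((x,ω),(y,ν)) ≍ (|ω·(x-y)| + |x-y|² + |ω-ν|²)^{1/2}, with implicit constants depending only on n. -/
open MeasureTheory Metric Set
open scoped ENNReal NNReal FourierTransform

noncomputable section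

abbrev En (n : ℕ) := EuclideanSpace ℝ (Fin n)
abbrev Sph (n : ℕ) := Metric.sphere (0 : En n) 1
abbrev CoSph (n : ℕ) := En n × Sph n

/-- The quasi-metric ρ((x,ω),(y,ν)) = (|ω·(x−y)| + |x−y|² + |ω−ν|²)^{1/2}. -/
def rho {n : ℕ} (a b : CoSph n) : ℝ :=
  Real.sqrt (abs (inner (𝕜 := ℝ) ((a.2 : En n)) (a.1 - b.1)) + ‖a.1 - b.1‖ ^ 2 +
    ‖(a.2 : En n) - (b.2 : En n)‖ ^ 2)

/-- The normalized surface measure on the unit sphere. -/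
def sphMeasure (n : ℕ) : Measure (Sph n) :=
  ((volume : Measure (En n)).toSphere Set.univ)⁻¹ • (volume : Measure (En n)).toSphere

/-- The measure dx dω on the cosphere bundle S* = ℝⁿ × S^{n-1}. -/
def muS (n : ℕ) : Measure (CoSph n) := (volume : Measure (En n)).prod (sphMeasure n)

/-- Ball in the quasi-metric ρ. -/
def rball {n : ℕ} (a : CoSph n) (τ : ℝ) : Set (CoSph n) := {b | rho a b < τ}

/-- A curve `γ : ℝ → ℝⁿ × ℝⁿ` is an admissible (piecewise Lipschitz, Legendrian) curve
from `a` to `b` in the cosphere bundle, with a.e. derivative `g`: it stays on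
ℝⁿ × S^{n-1}, joins the two points, is piecewise Lipschitz on [0,1], has derivative `g`
almost everywhere on (0,1), and satisfies the contact condition ω(s)·(dx/ds) = 0 a.e. -/
def IsAdmissibleCurve {n : ℕ} (a b : CoSph n) (γ g : ℝ → En n × En n) : Prop :=
  (∀ t ∈ Set.Icc (0 : ℝ) 1, ‖(γ t).2‖ = 1) ∧
  γ 0 = (a.1, (a.2 : En n)) ∧ γ 1 = (b.1, (b.2 : En n)) ∧
  (∃ (k : ℕ) (τ : ℕ → ℝ), τ 0 = 0 ∧ τ k = 1 ∧ (∀ i < k, τ i ≤ τ (i + 1)) ∧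
    ∀ i < k, ∃ Ki : ℝ≥0, LipschitzOnWith Ki γ (Set.Icc (τ i) (τ (i + 1)))) ∧
  (∀ᵐ t ∂(volume.restrict (Set.Ioo (0 : ℝ) 1)),
    HasDerivAt γ (g t) t ∧ inner (𝕜 := ℝ) ((γ t).2) ((g t).1) = (0 : ℝ))

/-- The sub-Riemannian (Carnot–Carathéodory) distance on the cosphere bundle: the infimum
of Riemannian lengths ∫₀¹ (‖x'(s)‖² + ‖ω'(s)‖²)^{1/2} ds over admissible Legendrian curves. -/
def subRiemDist {n : ℕ} (a b : CoSph n) : ℝ :=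
  sInf {L | ∃ γ g : ℝ → En n × En n, IsAdmissibleCurve a b γ g ∧
    L = ∫ t in Set.Ioo (0 : ℝ) 1, Real.sqrt (‖(g t).1‖ ^ 2 + ‖(g t).2‖ ^ 2)}

lemma lip_glue {X : Type*} [PseudoMetricSpace X] {f : ℝ → X} {a b c : ℝ} {K₁ K₂ : ℝ≥0}
    (hab : a ≤ b) (hbc : b ≤ c)
    (h1 : LipschitzOnWith K₁ f (Icc a b)) (h2 : LipschitzOnWith K₂ f (Icc b c)) :
    LipschitzOnWith (K₁ + K₂) f (Icc a c) := by
  have key : ∀ s ∈ Icc a c, ∀ t ∈ Icc a c, s ≤ t →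
      dist (f s) (f t) ≤ ((K₁ + K₂ : ℝ≥0) : ℝ) * dist s t := by
    intro s hs t ht hst
    have e : dist s t = t - s := by rw [dist_comm, Real.dist_eq, abs_of_nonneg (by linarith)]
    have k1 := K₁.coe_nonneg
    have k2 := K₂.coe_nonneg
    rw [e]; push_cast
    rcases le_total t b with h | h
    · have := h1.dist_le_mul s ⟨hs.1, hst.trans h⟩ t ⟨ht.1, h⟩
      rw [e] at this
      nlinarith [mul_nonneg k2 (sub_nonneg.2 hst)]
    rcases le_total b s with h' | h'
    · have := h2.dist_le_mul s ⟨h', hs.2⟩ t ⟨h, ht.2⟩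
      rw [e] at this
      nlinarith [mul_nonneg k1 (sub_nonneg.2 hst)]
    · have p1 := h1.dist_le_mul s ⟨hs.1, h'⟩ b ⟨hab, le_rfl⟩
      have p2 := h2.dist_le_mul b ⟨le_rfl, hbc⟩ t ⟨h, ht.2⟩
      have e1 : dist s b = b - s := by rw [dist_comm, Real.dist_eq, abs_of_nonneg (by linarith)]
      have e2 : dist b t = t - b := by rw [dist_comm, Real.dist_eq, abs_of_nonneg (by linarith)]
      rw [e1] at p1; rw [e2] at p2
      have := dist_triangle (f s) (f b) (f t)
      nlinarith [mul_nonneg k1 (sub_nonneg.2 h), mul_nonneg k2 (sub_nonneg.2 h')]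
  refine LipschitzOnWith.of_dist_le_mul fun s hs t ht => ?_
  rcases le_total s t with h | h
  · exact key s hs t ht h
  · rw [dist_comm, dist_comm s]; exact key t ht s hs h

lemma lip_chain {X : Type*} [PseudoMetricSpace X] {f : ℝ → X} (k : ℕ) (τ : ℕ → ℝ)
    (hm : ∀ i < k, τ i ≤ τ (i + 1))
    (hl : ∀ i < k, ∃ Ki : ℝ≥0, LipschitzOnWith Ki f (Icc (τ i) (τ (i + 1)))) :
    τ 0 ≤ τ k ∧ ∃ K : ℝ≥0, LipschitzOnWith K f (Icc (τ 0) (τ k)) := by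
  induction k with
  | zero => exact ⟨le_rfl, 0, by simp [LipschitzOnWith]⟩
  | succ k ih =>
    obtain ⟨h, K, hK⟩ := ih (fun i hi => hm i (by omega)) (fun i hi => hl i (by omega))
    obtain ⟨K', hK'⟩ := hl k (by omega)
    exact ⟨h.trans (hm k (by omega)), K + K', lip_glue h (hm k (by omega)) hK hK'⟩

lemma inner_sub_le_integral {F : Type*} [NormedAddCommGroup F] [InnerProductSpace ℝ F]
    {f g : ℝ → F} {K : ℝ≥0} (hf : LipschitzOnWith K f (Icc 0 1)) {s : ℝ} (hs : s ∈ Icc (0:ℝ) 1)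
    (u : F) {φ : ℝ → ℝ} (hφ : IntegrableOn φ (Ioo 0 1)) (hφ0 : ∀ t, 0 ≤ φ t)
    (hd : ∀ᵐ t ∂(volume.restrict (Ioo (0:ℝ) 1)),
      HasDerivAt f (g t) t ∧ |inner ℝ u (g t)| ≤ φ t) :
    |inner ℝ u (f s - f 0)| ≤ ∫ t in Ioo (0:ℝ) 1, φ t := by
  set h : ℝ → ℝ := fun t => inner ℝ u (f t) with hh
  have hlip : LipschitzOnWith (‖u‖₊ * K) h (uIcc 0 s) := by
    rw [uIcc_of_le hs.1]
    refine LipschitzOnWith.of_dist_le_mul fun a ha b hb => ?_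
    have := hf.dist_le_mul a ⟨ha.1, ha.2.trans hs.2⟩ b ⟨hb.1, hb.2.trans hs.2⟩
    rw [dist_eq_norm] at this
    rw [Real.dist_eq, hh]
    simp only
    rw [← inner_sub_right]
    push_cast
    calc _ ≤ ‖u‖ * ‖f a - f b‖ := abs_real_inner_le_norm _ _
      _ ≤ ‖u‖ * (K * dist a b) := by gcongr
      _ = _ := by ring
  have ftc := hlip.absolutelyContinuousOnInterval.integral_deriv_eq_sub
  have e : inner ℝ u (f s - f 0) = h s - h 0 := by rw [hh, inner_sub_right]
  rw [e, ← ftc, intervalIntegral.integral_of_le hs.1, ← integral_Ioc_eq_integral_Ioo]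
  have hφ' : IntegrableOn φ (Ioc 0 1) := by rwa [integrableOn_Ioc_iff_integrableOn_Ioo]
  have sub : Ioc (0:ℝ) s ⊆ Ioc 0 1 := Ioc_subset_Ioc_right hs.2
  have hd' : ∀ᵐ t ∂(volume.restrict (Ioc (0:ℝ) s)), ‖deriv h t‖ ≤ φ t := by
    rw [← restrict_Ioo_eq_restrict_Ioc]
    refine ae_mono (Measure.restrict_mono (Ioo_subset_Ioo_right hs.2) le_rfl) ?_
    filter_upwards [hd] with t ht
    have : HasDerivAt h (inner ℝ u (g t)) t := by
      simpa using (hasDerivAt_const t u).inner ℝ ht.1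
    rw [this.deriv]; exact ht.2
  calc _ ≤ ∫ t in Ioc 0 s, φ t := by
        rw [← Real.norm_eq_abs]
        exact norm_integral_le_of_norm_le (hφ'.mono_set sub) hd'
    _ ≤ _ := setIntegral_mono_set hφ' (Filter.Eventually.of_forall hφ0)
        (Filter.Eventually.of_forall sub)

lemma norm_sub_le_integral {F : Type*} [NormedAddCommGroup F] [InnerProductSpace ℝ F]
    {f g : ℝ → F} {K : ℝ≥0} (hf : LipschitzOnWith K f (Icc 0 1)) {s : ℝ} (hs : s ∈ Icc (0:ℝ) 1)
    {φ : ℝ → ℝ} (hφ : IntegrableOn φ (Ioo 0 1)) (hφ0 : ∀ t, 0 ≤ φ t)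
    (hd : ∀ᵐ t ∂(volume.restrict (Ioo (0:ℝ) 1)),
      HasDerivAt f (g t) t ∧ ‖g t‖ ≤ φ t) :
    ‖f s - f 0‖ ≤ ∫ t in Ioo (0:ℝ) 1, φ t := by
  set u := f s - f 0 with hu
  have := inner_sub_le_integral hf hs u (φ := fun t => ‖u‖ * φ t) (hφ.const_mul _)
    (fun t => mul_nonneg (norm_nonneg _) (hφ0 t)) (g := g) (by
      filter_upwards [hd] with t ht
      refine ⟨ht.1, (abs_real_inner_le_norm _ _).trans ?_⟩
      gcongr; exact ht.2)
  rw [← hu, real_inner_self_eq_norm_sq, integral_const_mul, abs_of_nonneg (by positivity)] at this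
  rcases (norm_nonneg u).eq_or_lt with h | h
  · rw [← h]; exact integral_nonneg hφ0
  · nlinarith

lemma lower {n : ℕ} {a b : CoSph n} {γ g : ℝ → En n × En n} (h : IsAdmissibleCurve a b γ g) :
    rho a b ≤ 2 * ∫ t in Set.Ioo (0 : ℝ) 1, Real.sqrt (‖(g t).1‖ ^ 2 + ‖(g t).2‖ ^ 2) := by
  obtain ⟨hS, h0, h1, ⟨k, τ, hτ0, hτ1, hm, hl⟩, hae⟩ := h
  obtain ⟨-, K, hK⟩ := lip_chain k τ hm hl
  rw [hτ0, hτ1] at hK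
  set σ : ℝ → ℝ := fun t => Real.sqrt (‖(g t).1‖ ^ 2 + ‖(g t).2‖ ^ 2) with hσ
  have hσ0 : ∀ t, 0 ≤ σ t := fun t => Real.sqrt_nonneg _
  have hg1 : ∀ t, ‖(g t).1‖ ≤ σ t := fun t => Real.le_sqrt_of_sq_le (by nlinarith [sq_nonneg ‖(g t).2‖])
  have hg2 : ∀ t, ‖(g t).2‖ ≤ σ t := fun t => Real.le_sqrt_of_sq_le (by nlinarith [sq_nonneg ‖(g t).1‖])
  have hgm : AEStronglyMeasurable g (volume.restrict (Ioo (0:ℝ) 1)) := by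
    refine (stronglyMeasurable_deriv γ).aestronglyMeasurable.congr ?_
    filter_upwards [hae] with t ht using ht.1.deriv
  have hσm : AEStronglyMeasurable σ (volume.restrict (Ioo (0:ℝ) 1)) := by
    have c : Continuous fun p : En n × En n => Real.sqrt (‖p.1‖ ^ 2 + ‖p.2‖ ^ 2) := by fun_prop
    exact c.comp_aestronglyMeasurable hgm
  have hσi : IntegrableOn σ (Ioo 0 1) := by
    refine Integrable.of_bound hσm (2 * K) ?_
    filter_upwards [hae, ae_restrict_mem measurableSet_Ioo] with t ht ht'
    have := ht.1.le_of_lipschitzOn (Icc_mem_nhds ht'.1 ht'.2) hK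
    rw [Real.norm_eq_abs, abs_of_nonneg (hσ0 t)]
    refine Real.sqrt_le_iff.2 ⟨by positivity, ?_⟩
    have a1 := (norm_fst_le (g t)).trans this
    have a2 := (norm_snd_le (g t)).trans this
    nlinarith [norm_nonneg (g t).1, norm_nonneg (g t).2]
  set L := ∫ t in Ioo (0:ℝ) 1, σ t with hL
  have hL0 : 0 ≤ L := integral_nonneg hσ0
  have hKx : LipschitzOnWith K (fun t => (γ t).1) (Icc 0 1) := by
    simpa [Function.comp_def] using LipschitzWith.prod_fst.comp_lipschitzOnWith hK
  have hKw : LipschitzOnWith K (fun t => (γ t).2) (Icc 0 1) := by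
    simpa [Function.comp_def] using LipschitzWith.prod_snd.comp_lipschitzOnWith hK
  have X := norm_sub_le_integral hKx (s := 1) (by simp) hσi hσ0 (g := fun t => (g t).1) (by
    filter_upwards [hae] with t ht using ⟨ht.1.fst, hg1 t⟩)
  have W : ∀ s ∈ Icc (0:ℝ) 1, ‖(γ s).2 - (γ 0).2‖ ≤ L := fun s hs =>
    norm_sub_le_integral hKw hs hσi hσ0 (g := fun t => (g t).2) (by
    filter_upwards [hae] with t ht using ⟨ht.1.snd, hg2 t⟩)
  have Z := inner_sub_le_integral hKx (s := 1) (by simp) (γ 0).2 (φ := fun t => L * σ t)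
    (hσi.const_mul _) (fun t => mul_nonneg hL0 (hσ0 t)) (g := fun t => (g t).1) (by
    filter_upwards [hae, ae_restrict_mem measurableSet_Ioo] with t ht ht'
    refine ⟨ht.1.fst, ?_⟩
    have e : inner ℝ (γ 0).2 (g t).1 = - inner ℝ ((γ t).2 - (γ 0).2) (g t).1 := by
      rw [inner_sub_left, ht.2]; ring
    rw [e, abs_neg]
    refine (abs_real_inner_le_norm _ _).trans ?_
    exact mul_le_mul (W t ⟨ht'.1.le, ht'.2.le⟩) (hg1 t) (norm_nonneg _) hL0)
  have W1 := W 1 (by simp)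
  rw [integral_const_mul, ← hL] at Z
  simp only [h0, h1] at X W1 Z
  rw [norm_sub_rev] at X W1
  rw [← neg_sub, inner_neg_right, abs_neg] at Z
  refine Real.sqrt_le_iff.2 ⟨by positivity, ?_⟩
  nlinarith [norm_nonneg (a.1 - b.1), norm_nonneg ((a.2 : En n) - b.2)]

def Reach {n : ℕ} (P Q : En n × En n) (M : ℝ) : Prop :=
  ∃ (γ g : ℝ → En n × En n) (F : Set ℝ), F.Finite ∧ (∀ t ∈ Icc (0:ℝ) 1, ‖(γ t).2‖ = 1) ∧
    γ 0 = P ∧ γ 1 = Q ∧ (∃ K : ℝ≥0, LipschitzOnWith K γ (Icc 0 1)) ∧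
    ∀ t ∈ Ioo (0:ℝ) 1, t ∉ F → HasDerivAt γ (g t) t ∧ inner ℝ (γ t).2 (g t).1 = 0 ∧
      ‖(g t).1‖ ≤ M ∧ ‖(g t).2‖ ≤ M

lemma Reach.mono {n : ℕ} {P Q : En n × En n} {M M' : ℝ} (h : Reach P Q M) (hM : M ≤ M') :
    Reach P Q M' := by
  obtain ⟨γ, g, F, hF, h1, h2, h3, h4, h5⟩ := h
  exact ⟨γ, g, F, hF, h1, h2, h3, h4, fun t ht htF =>
    ⟨(h5 t ht htF).1, (h5 t ht htF).2.1, (h5 t ht htF).2.2.1.trans hM,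
      (h5 t ht htF).2.2.2.trans hM⟩⟩

lemma Reach.trans {n : ℕ} {P Q R : En n × En n} {M : ℝ} (h : Reach P Q M) (h' : Reach Q R M) :
    Reach P R (2 * M) := by
  obtain ⟨γ, g, F, hF, h1, h2, h3, ⟨K, h4⟩, h5⟩ := h
  obtain ⟨γ', g', F', hF', h1', h2', h3', ⟨K', h4'⟩, h5'⟩ := h'
  set c : ℝ → En n × En n := fun t => if t ≤ 1/2 then γ (2 * t) else γ' (2 * t - 1) with hc
  have cL : ∀ t, t ≤ 1/2 → c t = γ (2 * t) := fun t ht => by simp only [hc]; rw [if_pos ht]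
  have cR : ∀ t, 1/2 ≤ t → c t = γ' (2 * t - 1) := fun t ht => by
    rcases ht.eq_or_lt with h | h
    · rw [← h, cL _ le_rfl]; norm_num; rw [h3, h2']
    · simp only [hc]; rw [if_neg (not_le.2 h)]
  refine ⟨c, fun t => if t ≤ 1/2 then (2:ℝ) • g (2 * t) else (2:ℝ) • g' (2 * t - 1),
    (fun t => t / 2) '' F ∪ ((fun t => (t + 1) / 2) '' F' ∪ {1/2}),
    (hF.image _).union ((hF'.image _).union (finite_singleton _)), ?_, ?_, ?_, ?_, ?_⟩
  · intro t ht
    rcases le_total t (1/2) with h | h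
    · rw [cL t h]; exact h1 _ ⟨by linarith [ht.1], by linarith⟩
    · rw [cR t h]; exact h1' _ ⟨by linarith, by linarith [ht.2]⟩
  · rw [cL _ (by norm_num)]; simpa using h2
  · rw [cR _ (by norm_num)]; norm_num; exact h3'
  · refine ⟨K * 2 + K' * 2, lip_glue (b := 1/2) (by norm_num) (by norm_num) ?_ ?_⟩
    · refine LipschitzOnWith.of_dist_le_mul fun s hs t ht => ?_
      rw [cL s hs.2, cL t ht.2]
      refine (h4.dist_le_mul _ ⟨by linarith [hs.1], by linarith [hs.2]⟩ _
        ⟨by linarith [ht.1], by linarith [ht.2]⟩).trans (le_of_eq ?_)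
      rw [Real.dist_eq, Real.dist_eq, ← mul_sub, abs_mul]; push_cast; norm_num; ring
    · refine LipschitzOnWith.of_dist_le_mul fun s hs t ht => ?_
      rw [cR s hs.1, cR t ht.1]
      refine (h4'.dist_le_mul _ ⟨by linarith [hs.1], by linarith [hs.2]⟩ _
        ⟨by linarith [ht.1], by linarith [ht.2]⟩).trans (le_of_eq ?_)
      have : 2 * s - 1 - (2 * t - 1) = 2 * (s - t) := by ring
      rw [Real.dist_eq, Real.dist_eq, this, abs_mul]; push_cast; norm_num; ring
  · intro t ht htF
    have n1 : 2 * t ∉ F := fun h => htF (Or.inl ⟨2 * t, h, by simp⟩)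
    have n2 : 2 * t - 1 ∉ F' := fun h => htF (Or.inr (Or.inl ⟨2 * t - 1, h, by simp⟩))
    have n3 : t ≠ 1/2 := fun h => htF (Or.inr (Or.inr h))
    rcases lt_or_gt_of_ne n3 with h | h
    · obtain ⟨d, i, b1, b2⟩ := h5 (2 * t) ⟨by linarith [ht.1], by linarith⟩ n1
      rw [cL t h.le]
      simp only [if_pos h.le]
      refine ⟨?_, ?_, ?_, ?_⟩
      · have e : HasDerivAt (fun t : ℝ => 2 * t) 2 t := by
          simpa using (hasDerivAt_id t).const_mul (2:ℝ)
        refine (HasDerivAt.scomp t d e).congr_of_eventuallyEq ?_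
        filter_upwards [Iio_mem_nhds h] with y hy using cL y (le_of_lt hy)
      · simp [inner_smul_right, i]
      · simp only [Prod.smul_fst, norm_smul]; norm_num; exact b1
      · simp only [Prod.smul_snd, norm_smul]; norm_num; exact b2
    · obtain ⟨d, i, b1, b2⟩ := h5' (2 * t - 1) ⟨by linarith, by linarith [ht.2]⟩ n2
      rw [cR t h.le]
      simp only [if_neg (not_le.2 h)]
      refine ⟨?_, ?_, ?_, ?_⟩
      · have e : HasDerivAt (fun t : ℝ => 2 * t - 1) 2 t := by
          simpa using ((hasDerivAt_id t).const_mul (2:ℝ)).sub_const 1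
        refine (HasDerivAt.scomp t d e).congr_of_eventuallyEq ?_
        filter_upwards [Ioi_mem_nhds h] with y hy using cR y (le_of_lt hy)
      · simp [inner_smul_right, i]
      · simp only [Prod.smul_fst, norm_smul]; norm_num; exact b1
      · simp only [Prod.smul_snd, norm_smul]; norm_num; exact b2

lemma reach_of_deriv {n : ℕ} (γ g : ℝ → En n × En n) (M : ℝ) (hM : 0 ≤ M)
    (hS : ∀ t, ‖(γ t).2‖ = 1) (hd : ∀ t, HasDerivAt γ (g t) t)
    (hi : ∀ t, inner ℝ (γ t).2 (g t).1 = 0) (h1 : ∀ t, ‖(g t).1‖ ≤ M) (h2 : ∀ t, ‖(g t).2‖ ≤ M) :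
    Reach (γ 0) (γ 1) M := by
  refine ⟨γ, g, ∅, finite_empty, fun t _ => hS t, rfl, rfl, ⟨M.toNNReal, ?_⟩,
    fun t _ _ => ⟨hd t, hi t, h1 t, h2 t⟩⟩
  refine (convex_Icc 0 1).lipschitzOnWith_of_nnnorm_hasDerivWithin_le (f' := g)
    (fun x _ => (hd x).hasDerivWithinAt) (fun x _ => ?_)
  rw [← NNReal.coe_le_coe, Real.coe_toNNReal M hM]
  exact norm_prod_le_iff.2 ⟨h1 x, h2 x⟩

lemma reach_trans {n : ℕ} (x w v : En n) (hw : ‖w‖ = 1) (hv : inner ℝ w v = 0) :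
    Reach (x, w) (x + v, w) ‖v‖ := by
  have := reach_of_deriv (fun t : ℝ => (x + t • v, w)) (fun _ => (v, 0)) ‖v‖ (norm_nonneg _)
    (fun _ => hw) (fun t => by
      refine HasDerivAt.prodMk ?_ (hasDerivAt_const _ _)
      simpa using ((hasDerivAt_id t).smul_const v).const_add x) (fun _ => hv) (fun _ => le_rfl)
      (fun _ => by simp)
  simpa using this

lemma rot_norm {n : ℕ} (w e : En n) (hw : ‖w‖ = 1) (he : ‖e‖ = 1)
    (hwe : inner ℝ w e = 0) (p q : ℝ) : ‖p • w + q • e‖ ^ 2 = p ^ 2 + q ^ 2 := by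
  rw [norm_add_sq_real, norm_smul, norm_smul, inner_smul_left, inner_smul_right, hwe, hw, he]
  simp

lemma reach_rot {n : ℕ} (x w e : En n) (hw : ‖w‖ = 1) (he : ‖e‖ = 1) (hwe : inner ℝ w e = 0)
    (α β : ℝ) :
    Reach (x, Real.cos α • w + Real.sin α • e) (x, Real.cos β • w + Real.sin β • e) |β - α| := by
  have := reach_of_deriv
    (fun t : ℝ => (x, Real.cos (α + t * (β - α)) • w + Real.sin (α + t * (β - α)) • e))
    (fun t => (0, (-Real.sin (α + t * (β - α)) * (β - α)) • w
      + (Real.cos (α + t * (β - α)) * (β - α)) • e)) |β - α| (abs_nonneg _)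
    (fun t => by
      have := rot_norm w e hw he hwe (Real.cos (α + t * (β - α))) (Real.sin (α + t * (β - α)))
      rw [Real.cos_sq_add_sin_sq] at this
      simpa using (pow_eq_one_iff_of_nonneg (norm_nonneg _) two_ne_zero).1 this)
    (fun t => by
      refine HasDerivAt.prodMk (hasDerivAt_const _ _) ?_
      have d : HasDerivAt (fun t : ℝ => α + t * (β - α)) (β - α) t := by
        simpa using ((hasDerivAt_id t).mul_const (β - α)).const_add α
      exact (d.cos.smul_const w).add (d.sin.smul_const e))
    (fun _ => by simp) (fun _ => by simp)
    (fun t => by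
      refine le_of_sq_le_sq ?_ (abs_nonneg _)
      rw [rot_norm w e hw he hwe, sq_abs]
      have := Real.sin_sq_add_cos_sq (α + t * (β - α))
      refine le_of_eq ?_
      linear_combination (β - α) ^ 2 * this)
  simpa using this

lemma exists_perp {n : ℕ} (hn : 2 ≤ n) (w : En n) : ∃ e : En n, ‖e‖ = 1 ∧ inner ℝ w e = 0 := by
  have h1 : Module.finrank ℝ (ℝ ∙ w) ≤ 1 := by
    simpa using finrank_span_le_card (R := ℝ) ({w} : Set (En n))
  have h2 := Submodule.finrank_add_finrank_orthogonal (ℝ ∙ w)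
  rw [finrank_euclideanSpace_fin] at h2
  have : Nontrivial (ℝ ∙ w)ᗮ := Module.nontrivial_of_finrank_pos (R := ℝ) (by omega)
  obtain ⟨⟨v, hv⟩, hv0⟩ := exists_ne (0 : (ℝ ∙ w)ᗮ)
  have hv0' : v ≠ 0 := fun h => hv0 (by simpa using h)
  refine ⟨‖v‖⁻¹ • v, norm_smul_inv_norm hv0', ?_⟩
  rw [inner_smul_right, Submodule.mem_orthogonal_singleton_iff_inner_right.1 hv, mul_zero]

lemma le_two_sin {θ : ℝ} (h0 : 0 ≤ θ) (h1 : θ ≤ Real.pi / 2) : θ ≤ 2 * Real.sin θ := by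
  have := Real.mul_le_sin h0 h1
  have h4 := Real.pi_le_four
  have hp := Real.pi_pos
  have : 1 / 2 * θ ≤ 2 / Real.pi * θ := by
    gcongr ?_ * _
    rw [div_le_div_iff₀ (by norm_num) hp]; linarith
  linarith

lemma reach_sphere {n : ℕ} (hn : 2 ≤ n) (x w z : En n) (hw : ‖w‖ = 1) (hz : ‖z‖ = 1) :
    Reach (x, w) (x, z) (2 * ‖w - z‖) := by
  obtain ⟨e, he, hwe, hz'⟩ : ∃ e : En n, ‖e‖ = 1 ∧ inner ℝ w e = 0 ∧
      z = Real.cos (Real.arccos (inner ℝ w z)) • w + Real.sin (Real.arccos (inner ℝ w z)) • e := by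
    set c := inner ℝ w z with hc
    have hab : |c| ≤ 1 := by simpa [hw, hz] using abs_real_inner_le_norm w z
    rw [Real.cos_arccos (abs_le.1 hab).1 (abs_le.1 hab).2, Real.sin_arccos]
    have hn2 : ‖z - c • w‖ ^ 2 = 1 - c ^ 2 := by
      rw [norm_sub_sq_real, norm_smul, inner_smul_right, real_inner_comm, ← hc, hw, hz]
      simp; ring
    have hs : √(1 - c ^ 2) = ‖z - c • w‖ := by rw [← hn2, Real.sqrt_sq (norm_nonneg _)]
    rw [hs]
    by_cases h : z - c • w = 0
    · obtain ⟨e, he, hwe⟩ := exists_perp hn w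
      exact ⟨e, he, hwe, by rw [h]; simpa using sub_eq_zero.1 h⟩
    · refine ⟨‖z - c • w‖⁻¹ • (z - c • w), norm_smul_inv_norm h, ?_, ?_⟩
      · rw [inner_smul_right, inner_sub_right, inner_smul_right, ← hc,
          real_inner_self_eq_norm_sq, hw]; simp
      · rw [smul_inv_smul₀ (norm_ne_zero_iff.2 h)]; abel
  set θ := Real.arccos (inner ℝ w z) with hθ
  have r := reach_rot x w e hw he hwe 0 θ
  rw [← hz'] at r
  simp only [Real.cos_zero, Real.sin_zero, one_smul, zero_smul, add_zero, sub_zero] at r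
  refine r.mono ?_
  have t0 : 0 ≤ θ := Real.arccos_nonneg _
  have t1 : θ ≤ Real.pi := Real.arccos_le_pi _
  rw [abs_of_nonneg t0]
  have s := le_two_sin (θ := θ / 2) (by linarith) (by linarith)
  have : 2 * Real.sin (θ / 2) ≤ ‖w - z‖ := by
    refine le_of_sq_le_sq ?_ (norm_nonneg _)
    have hab : |inner ℝ w z| ≤ 1 := by simpa [hw, hz] using abs_real_inner_le_norm w z
    have c1 : Real.cos θ = inner ℝ w z := Real.cos_arccos (abs_le.1 hab).1 (abs_le.1 hab).2
    have c2 : Real.cos θ = 1 - 2 * Real.sin (θ / 2) ^ 2 := by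
      have := Real.cos_two_mul' (θ / 2)
      rw [mul_div_cancel₀ _ two_ne_zero] at this
      nlinarith [Real.sin_sq_add_cos_sq (θ / 2)]
    rw [norm_sub_sq_real, hw, hz, ← c1, c2]
    nlinarith
  linarith

lemma reach_main {n : ℕ} (hn : 2 ≤ n) (a b : CoSph n) :
    Reach (a.1, (a.2 : En n)) (b.1, (b.2 : En n)) (48 * rho a b) := by
  obtain ⟨x, ⟨w, hw⟩⟩ := a
  obtain ⟨y, ⟨z, hz⟩⟩ := b
  rw [mem_sphere_zero_iff_norm] at hw hz
  have A : 0 ≤ |inner ℝ w (x - y)| + ‖x - y‖ ^ 2 + ‖w - z‖ ^ 2 := by positivity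
  set r := rho ((x, ⟨w, by simpa using hw⟩) : CoSph n) (y, ⟨z, by simpa using hz⟩) with hr
  have hr2 : r ^ 2 = |inner ℝ w (x - y)| + ‖x - y‖ ^ 2 + ‖w - z‖ ^ 2 := Real.sq_sqrt A
  have hr0 : 0 ≤ r := Real.sqrt_nonneg _
  have hxy : ‖y - x‖ ≤ r := by
    rw [norm_sub_rev]
    refine le_of_sq_le_sq ?_ hr0
    nlinarith [abs_nonneg (inner ℝ w (x - y)), sq_nonneg ‖w - z‖]
  have hwz : ‖w - z‖ ≤ r := by
    refine le_of_sq_le_sq ?_ hr0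
    nlinarith [abs_nonneg (inner ℝ w (x - y)), sq_nonneg ‖x - y‖]
  set s := inner ℝ w (y - x) with hs
  have hs' : |inner ℝ w (x - y)| = |s| := by rw [← neg_sub, inner_neg_right, abs_neg]
  have hsr : |s| ≤ r := by
    refine (abs_real_inner_le_norm _ _).trans ?_
    rw [hw, one_mul]; exact hxy
  set q := √|s| with hq
  have hq0 : 0 ≤ q := Real.sqrt_nonneg _
  have hq2 : q ^ 2 = |s| := Real.sq_sqrt (abs_nonneg _)
  have hqr : q ≤ r := by
    refine le_of_sq_le_sq ?_ hr0
    nlinarith [sq_nonneg ‖w - z‖, sq_nonneg ‖x - y‖]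
  obtain ⟨ε, hε, hεs⟩ : ∃ ε : ℝ, |ε| = 1 ∧ s = - (ε * |s|) := by
    rcases le_total 0 s with h | h
    · exact ⟨-1, by simp, by rw [abs_of_nonneg h]; ring⟩
    · exact ⟨1, by simp, by rw [abs_of_nonpos h]; ring⟩
  obtain ⟨e, he, hwe⟩ := exists_perp hn w
  set u := q / (1 + q) with hu
  have hu0 : 0 ≤ u := by positivity
  have hu1 : u ≤ 1 := by rw [hu, div_le_one (by positivity)]; linarith
  have huq : u ≤ q := div_le_self hq0 (by linarith)
  have huq2 : u * (1 + q) = q := div_mul_cancel₀ _ (by positivity)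
  set θ := Real.arcsin u with hθ
  have hsin : Real.sin θ = u := Real.sin_arcsin (by linarith) hu1
  have hθ0 : 0 ≤ θ := Real.arcsin_nonneg.2 hu0
  have hθr : θ ≤ 2 * r := by
    have := le_two_sin hθ0 (Real.arcsin_le_pi_div_two u)
    rw [hsin] at this; linarith
  set l := ε * (q * (1 + q)) with hl
  have hl1 : |l| ≤ 2 * r := by
    rw [hl, abs_mul, hε, abs_of_nonneg (by positivity)]
    nlinarith
  set p := (-Real.sin θ) • w + Real.cos θ • e with hp
  have hpn : ‖p‖ = 1 := by
    have := rot_norm w e hw he hwe (-Real.sin θ) (Real.cos θ)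
    rw [neg_sq, Real.sin_sq_add_cos_sq] at this
    exact (pow_eq_one_iff_of_nonneg (norm_nonneg _) two_ne_zero).1 this
  set w' := Real.cos θ • w + Real.sin θ • e with hw'
  have hw'n : ‖w'‖ = 1 := by
    have := rot_norm w e hw he hwe (Real.cos θ) (Real.sin θ)
    rw [Real.cos_sq_add_sin_sq] at this
    exact (pow_eq_one_iff_of_nonneg (norm_nonneg _) two_ne_zero).1 this
  have hew : inner ℝ e w = 0 := by rw [real_inner_comm]; exact hwe
  have hw'p : inner ℝ w' p = 0 := by
    rw [hw', hp]
    simp only [inner_add_left, inner_add_right, inner_smul_left, inner_smul_right, hwe, hew,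
      real_inner_self_eq_norm_sq, hw, he]
    simp; ring
  have hwp : inner ℝ w p = - u := by
    rw [hp]
    simp only [inner_add_right, inner_smul_right, hwe, real_inner_self_eq_norm_sq, hw, hsin]
    ring
  have hlp : ‖l • p‖ = |l| := by rw [norm_smul, hpn, mul_one, Real.norm_eq_abs]
  set v := y - x - l • p with hv
  have hwv : inner ℝ w v = 0 := by
    rw [hv, inner_sub_right, inner_smul_right, hwp, ← hs, hεs, ← hq2, hl]
    linear_combination ε * q * huq2
  have hvn : ‖v‖ ≤ 3 * r := by
    refine (norm_sub_le _ _).trans ?_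
    rw [hlp]; linarith
  have R1 : Reach (x, w) (x, w') (3 * r) := by
    have := reach_rot x w e hw he hwe 0 θ
    simp only [Real.cos_zero, Real.sin_zero, one_smul, zero_smul, add_zero, sub_zero] at this
    exact this.mono (by rw [abs_of_nonneg hθ0]; linarith)
  have R2 : Reach (x, w') (x + l • p, w') (3 * r) :=
    (reach_trans x w' (l • p) hw'n (by rw [inner_smul_right, hw'p, mul_zero])).mono
      (by rw [hlp]; linarith)
  have R3 : Reach (x + l • p, w') (x + l • p, w) (3 * r) := by
    have := reach_rot (x + l • p) w e hw he hwe θ 0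
    simp only [Real.cos_zero, Real.sin_zero, one_smul, zero_smul, add_zero, zero_sub] at this
    exact this.mono (by rw [abs_neg, abs_of_nonneg hθ0]; linarith)
  have R4 : Reach (x + l • p, w) (y, w) (3 * r) := by
    have := (reach_trans (x + l • p) w v hw hwv).mono hvn
    have e : x + l • p + v = y := by rw [hv]; abel
    rwa [e] at this
  have R5 : Reach (y, w) (y, z) (3 * r) := (reach_sphere hn y w z hw hz).mono (by linarith)
  have := ((((R1.trans R2).trans (R3.trans R4))).trans (R5.mono (by linarith : _ ≤ 2 * (2 * (3 * r)))))
  exact this.mono (by linarith)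

lemma upper {n : ℕ} {a b : CoSph n} {M : ℝ} (hM : 0 ≤ M)
    (h : Reach (a.1, (a.2 : En n)) (b.1, (b.2 : En n)) M) :
    ∃ γ g : ℝ → En n × En n, IsAdmissibleCurve a b γ g ∧
      ∫ t in Set.Ioo (0 : ℝ) 1, Real.sqrt (‖(g t).1‖ ^ 2 + ‖(g t).2‖ ^ 2) ≤ 2 * M := by
  obtain ⟨γ, g, F, hF, h1, h2, h3, ⟨K, h4⟩, h5⟩ := h
  have hae : ∀ᵐ t ∂(volume.restrict (Ioo (0:ℝ) 1)), t ∈ Ioo (0:ℝ) 1 ∧ t ∉ F := by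
    filter_upwards [ae_restrict_mem measurableSet_Ioo,
      ae_restrict_of_ae (hF.countable.ae_notMem volume)] with t h h' using ⟨h, h'⟩
  refine ⟨γ, g, ⟨h1, h2, h3, ⟨1, fun i => i, by simp, by simp, by simp, ?_⟩, ?_⟩, ?_⟩
  · intro i hi
    obtain rfl : i = 0 := by omega
    exact ⟨K, by simpa using h4⟩
  · filter_upwards [hae] with t ht
    exact ⟨(h5 t ht.1 ht.2).1, (h5 t ht.1 ht.2).2.1⟩
  · refine (le_abs_self _).trans ?_
    have := norm_setIntegral_le_of_norm_le_const_ae (μ := volume) (s := Ioo (0:ℝ) 1)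
      (f := fun t => Real.sqrt (‖(g t).1‖ ^ 2 + ‖(g t).2‖ ^ 2)) (C := 2 * M) (by simp) (by
        filter_upwards [hae] with t ht
        obtain ⟨-, -, b1, b2⟩ := h5 t ht.1 ht.2
        rw [Real.norm_eq_abs, abs_of_nonneg (Real.sqrt_nonneg _)]
        refine Real.sqrt_le_iff.2 ⟨by positivity, ?_⟩
        nlinarith [norm_nonneg (g t).1, norm_nonneg (g t).2])
    simpa using this

/-- The sub-Riemannian distance on ℝⁿ × S^{n-1} is comparable to
(|ω·(x−y)| + |x−y|² + |ω−ν|²)^{1/2}, with constants depending only on n. -/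
theorem subRiemDist_equiv_rho (n : ℕ) (hn : 2 ≤ n) :
    ∃ c C : ℝ, 0 < c ∧ 0 < C ∧ ∀ a b : CoSph n,
      c * rho a b ≤ subRiemDist a b ∧ subRiemDist a b ≤ C * rho a b := by
  refine ⟨1 / 2, 96, by norm_num, by norm_num, fun a b => ?_⟩
  have hr0 : 0 ≤ rho a b := Real.sqrt_nonneg _
  obtain ⟨γ, g, hγ, hL⟩ := upper (by positivity) (reach_main hn a b)
  constructor
  · refine le_csInf ⟨_, γ, g, hγ, rfl⟩ ?_
    rintro L ⟨γ', g', h', rfl⟩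
    have := lower h'
    linarith
  · refine le_trans ?_ (hL.trans (by linarith : _ ≤ 96 * rho a b))
    refine csInf_le ⟨0, ?_⟩ ⟨γ, g, hγ, rfl⟩
    rintro L ⟨γ', g', h', rfl⟩
    exact integral_nonneg fun t => Real.sqrt_nonneg _
end
end

section
/- Let 0 < p ≤ 2 and let (F(x,ω,σ)) be measurable on (ℝⁿ × S^{n-1}) × (0,∞). Then (∫_{ℝⁿ×S^{n-1}} (∫₀^∞ |F(x,ω,σ)|² dσ/σ)^{p/2} dx dω)^{1/p} ≤ C ‖F‖_{T^p}, where ‖F‖_{T^p} = ‖A F‖_{L^p(ℝⁿ×S^{n-1})} with A F(x,ω) = (∫₀^∞ ⨍_{B_{√σ}(x,ω)} |F(y,ν,σ)|² dy dν dσ/σ)^{1/2}, the conical square function over balls in the quasi-metric ρ. That is, the vertical square function is dominated by the conical one for p ≤ 2. -/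
open MeasureTheory Metric Set
open scoped ENNReal NNReal FourierTransform

noncomputable section

/-- The conical square function A F(x,ω) = (∫₀^∞ ⨍_{B_{√σ}(x,ω)} |F(y,ν,σ)|² dy dν dσ/σ)^{1/2}. -/
def conSF {n : ℕ} (F : CoSph n × ℝ → ℂ) (a : CoSph n) : ℝ≥0∞ :=
  (∫⁻ σ in Set.Ioi (0 : ℝ),
      (muS n (rball a (Real.sqrt σ)))⁻¹ *
        (∫⁻ b in rball a (Real.sqrt σ), (‖F (b, σ)‖₊ : ℝ≥0∞) ^ (2 : ℝ) ∂(muS n)) *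
        ENNReal.ofReal σ⁻¹) ^ (1 / 2 : ℝ)


lemma upper_bd (φ : ℝ → ℝ≥0∞) (t : ℝ≥0∞) :
    ∫⁻ s in {s : ℝ | 0 < s ∧ ∫⁻ u in Ici s, φ u ≤ t}, φ s ≤ t := by
  set S := {s : ℝ | 0 < s ∧ ∫⁻ u in Ici s, φ u ≤ t} with hS
  have up : ∀ s ∈ S, ∀ u, s ≤ u → u ∈ S := fun s hs u hu =>
    ⟨hs.1.trans_le hu, (lintegral_mono_set (Ici_subset_Ici.2 hu)).trans hs.2⟩
  by_cases hne : S.Nonempty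
  swap
  · rw [not_nonempty_iff_eq_empty.1 hne]; simp
  have bdd : BddBelow S := ⟨0, fun s hs => hs.1.le⟩
  by_cases hm : sInf S ∈ S
  · exact (lintegral_mono_set (fun s hs => csInf_le bdd hs)).trans hm.2
  · obtain ⟨x, hx1, hx2, hx3⟩ := exists_seq_strictAnti_tendsto (sInf S)
    have hxS : ∀ k, x k ∈ S := fun k => by
      obtain ⟨s, hs, hsx⟩ := exists_lt_of_csInf_lt hne (hx2 k)
      exact up s hs _ hsx.le
    have hU : S ⊆ ⋃ k, Ici (x k) := fun s hs => by
      have : sInf S < s := lt_of_le_of_ne (csInf_le bdd hs) (fun h => hm (h ▸ hs))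
      obtain ⟨k, hk⟩ := (hx3.eventually (gt_mem_nhds this)).exists
      exact mem_iUnion.2 ⟨k, hk.le⟩
    refine (lintegral_mono_set hU).trans ?_
    have hdir : Directed (· ⊆ ·) (fun k => Ici (x k)) :=
      Monotone.directed_le (f := fun k => Ici (x k)) (fun i j hij => Ici_subset_Ici.2 (hx1.antitone hij))
    rw [setLIntegral_iUnion_of_directed _ hdir]
    exact iSup_le fun k => (hxS k).2

lemma rpow_anti {x y : ℝ≥0∞} {z : ℝ} (hz : z ≤ 0) (h : x ≤ y) : y ^ z ≤ x ^ z := by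
  rw [← neg_neg z, ENNReal.rpow_neg, ENNReal.rpow_neg x]
  exact ENNReal.inv_le_inv.2 (ENNReal.rpow_le_rpow h (by linarith))

lemma dyadic_pt {q : ℝ} (hq1 : q ≤ 1) (x T : ℝ≥0∞) (hx : x ≠ 0) (hxT : x ≤ T) (hT : T ≠ ⊤) :
    x ^ (q - 1) ≤ ∑' k : ℕ, (if x ≤ (2⁻¹) ^ k * T then 1 else 0) * ((2⁻¹) ^ (k + 1) * T) ^ (q - 1) := by
  have hT0 : T ≠ 0 := fun h => hx (by simpa [h] using hxT)
  have hxt : x ≠ ⊤ := (hxT.trans_lt hT.lt_top).ne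
  have h1 : 0 < (x / T).toReal := ENNReal.toReal_pos (by simp [hx, hT]) (ENNReal.div_ne_top hxt hT0)
  have h2 : (x / T).toReal ≤ 1 := by
    refine ENNReal.toReal_le_of_le_ofReal zero_le_one ?_
    simpa using ENNReal.div_le_of_le_mul (by simpa using hxT)
  obtain ⟨k, hk1, hk2⟩ := exists_nat_pow_near_of_lt_one h1 h2 (y := (2⁻¹ : ℝ)) (by norm_num) (by norm_num)
  have e : ∀ j : ℕ, ENNReal.ofReal ((2⁻¹ : ℝ) ^ j) = (2⁻¹ : ℝ≥0∞) ^ j := fun j => by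
    rw [ENNReal.ofReal_pow (by norm_num), ENNReal.ofReal_inv_of_pos (by norm_num)]; simp
  have hxe : x = ENNReal.ofReal (x / T).toReal * T := by
    rw [ENNReal.ofReal_toReal (ENNReal.div_ne_top hxt hT0), ENNReal.div_mul_cancel hT0 hT]
  have k1 : (2⁻¹) ^ (k + 1) * T ≤ x := by
    rw [hxe, ← e]; gcongr
  have k2 : x ≤ (2⁻¹) ^ k * T := by
    rw [hxe, ← e]; gcongr
  refine le_trans ?_ (ENNReal.le_tsum k)
  rw [if_pos k2, one_mul]
  exact rpow_anti (by linarith) k1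

lemma oneD {q : ℝ} (hq0 : 0 < q) (hq1 : q ≤ 1) : ∃ C : ℝ≥0∞, C ≠ ⊤ ∧ ∀ φ : ℝ → ℝ≥0∞, Measurable φ →
    ∫⁻ s in Ioi (0:ℝ), φ s * (∫⁻ u in Ici s, φ u) ^ (q - 1) ≤ C * (∫⁻ s in Ioi (0:ℝ), φ s) ^ q := by
  have hr : (2⁻¹ : ℝ≥0∞) ^ q < 1 := ENNReal.rpow_lt_one (by simp) hq0
  refine ⟨1 + 2⁻¹ ^ (q-1) * (1 - 2⁻¹ ^ q)⁻¹, ?_, ?_⟩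
  · refine ENNReal.add_ne_top.2 ⟨by simp, ENNReal.mul_ne_top ?_ ?_⟩
    · exact ENNReal.rpow_ne_top_of_ne_zero (by simp) (by simp)
    · simpa [tsub_eq_zero_iff_le] using hr
  intro φ hφ
  set T := ∫⁻ s in Ioi (0:ℝ), φ s with hTdef
  by_cases hT : T = ⊤
  · rw [hT, ENNReal.top_rpow_of_pos hq0, ENNReal.mul_top (by simp)]; exact le_top
  have hΦm : Measurable fun s : ℝ => ∫⁻ u in Ici s, φ u := by
    have : Antitone fun s : ℝ => ∫⁻ u in Ici s, φ u := fun s t h => lintegral_mono_set (Ici_subset_Ici.2 h)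
    exact this.measurable
  set Φ := fun s : ℝ => ∫⁻ u in Ici s, φ u with hΦ
  have hΦT : ∀ s, 0 < s → Φ s ≤ T := fun s hs => lintegral_mono_set (Ici_subset_Ioi.2 hs)
  have key : ∀ t, ∫⁻ s in Ioi (0:ℝ), (if Φ s ≤ t then 1 else 0) * φ s ≤ t := fun t => by
    refine le_trans (le_of_eq ?_) (upper_bd φ t)
    have : {s : ℝ | 0 < s ∧ ∫⁻ u in Ici s, φ u ≤ t} = {s | Φ s ≤ t} ∩ Ioi 0 := by
      ext s; simp [hΦ, and_comm]
    rw [this, ← Measure.restrict_restrict (measurableSet_le hΦm measurable_const), 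
      ← lintegral_indicator (measurableSet_le hΦm measurable_const)]
    refine lintegral_congr fun s => ?_
    by_cases h : Φ s ≤ t <;> simp [indicator, h]
  have hz : ∀ᵐ s ∂(volume.restrict (Ioi (0:ℝ))), (if Φ s ≤ 0 then 1 else 0) * φ s = 0 := by
    have := le_antisymm (key 0) (zero_le)
    rwa [lintegral_eq_zero_iff (by
      exact (Measurable.ite (measurableSet_le hΦm measurable_const) measurable_const measurable_const).mul hφ)] at this
  have hmm : ∀ t, Measurable fun s => (if Φ s ≤ t then (1:ℝ≥0∞) else 0) := fun t =>
    Measurable.ite (measurableSet_le hΦm measurable_const) measurable_const measurable_const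
  calc ∫⁻ s in Ioi (0:ℝ), φ s * Φ s ^ (q - 1) 
      ≤ ∫⁻ s in Ioi (0:ℝ), ∑' k : ℕ, ((2⁻¹) ^ (k + 1) * T) ^ (q - 1) * ((if Φ s ≤ (2⁻¹) ^ k * T then 1 else 0) * φ s) := by
        refine lintegral_mono_ae ?_
        filter_upwards [hz, ae_restrict_mem measurableSet_Ioi] with s hs hs0
        by_cases h0 : Φ s = 0
        · have : φ s = 0 := by simpa [h0] using hs
          simp [this]
        · refine (mul_le_mul_right (dyadic_pt hq1 _ T h0 (hΦT s hs0) hT) (φ s)).trans (le_of_eq ?_)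
          rw [← ENNReal.tsum_mul_left]
          refine tsum_congr fun k => by ring
    _ = ∑' k : ℕ, ((2⁻¹) ^ (k + 1) * T) ^ (q - 1) * ∫⁻ s in Ioi (0:ℝ), (if Φ s ≤ (2⁻¹) ^ k * T then 1 else 0) * φ s := by
        rw [lintegral_tsum]
        · refine tsum_congr fun k => ?_
          exact lintegral_const_mul _ ((hmm _).mul hφ)
        · intro k
          exact (((hmm ((2⁻¹) ^ k * T)).mul hφ).const_mul _).aemeasurable
    _ ≤ ∑' k : ℕ, 2⁻¹ ^ (q-1) * T ^ q * (2⁻¹ ^ q) ^ k := by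
        refine ENNReal.tsum_le_tsum fun k => ?_
        refine (mul_le_mul_right (key _) _).trans ?_
        by_cases hT0 : T = 0
        · simp [hT0]
        refine le_of_eq ?_
        have h2 : (2⁻¹:ℝ≥0∞)^k ≠ 0 := by simp
        have h2' : (2⁻¹:ℝ≥0∞)^k ≠ ⊤ := by simp
        rw [pow_succ', mul_assoc, ENNReal.mul_rpow_of_ne_top (by simp) (ENNReal.mul_ne_top h2' hT), mul_assoc, mul_assoc]
        congr 1
        have hM0 : (2⁻¹:ℝ≥0∞)^k * T ≠ 0 := mul_ne_zero h2 hT0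
        have hM : (2⁻¹:ℝ≥0∞)^k * T ≠ ⊤ := ENNReal.mul_ne_top h2' hT
        have : ((2⁻¹:ℝ≥0∞)^k * T)^(q-1) * ((2⁻¹:ℝ≥0∞)^k * T) = ((2⁻¹:ℝ≥0∞)^k * T)^q := by
          conv_lhs => rw [← ENNReal.rpow_one ((2⁻¹:ℝ≥0∞)^k * T), ← ENNReal.rpow_mul, one_mul]
          rw [← ENNReal.rpow_add _ _ hM0 hM]; simp
        rw [this, ENNReal.mul_rpow_of_nonneg _ _ hq0.le, mul_comm]
        congr 1
        rw [← ENNReal.rpow_natCast, ← ENNReal.rpow_natCast, ← ENNReal.rpow_mul, ← ENNReal.rpow_mul, mul_comm]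
    _ = 2⁻¹ ^ (q-1) * (1 - 2⁻¹ ^ q)⁻¹ * T ^ q := by
        rw [ENNReal.tsum_mul_left, ENNReal.tsum_geometric]; ring
    _ ≤ _ := by gcongr; exact le_add_self

lemma holder_fin {X : Type*} [MeasurableSpace X] (μ : Measure X) {q : ℝ} (hq0 : 0 < q) (hq1 : q ≤ 1)
    (V H : X → ℝ≥0∞) (hV : Measurable V) (hH : Measurable H) (C : ℝ≥0∞) (hC : C ≠ ⊤)
    (h : ∫⁻ a, V a * H a ^ (q - 1) ∂μ ≤ C * ∫⁻ a, H a ^ q ∂μ) :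
    ∫⁻ a, V a ^ q ∂μ ≤ (C ^ q + 1) * ∫⁻ a, H a ^ q ∂μ := by
  set I := ∫⁻ a, H a ^ q ∂μ with hI
  by_cases hIt : I = ⊤
  · rw [hIt, ENNReal.mul_top (by simp)]; exact le_top
  have m1 : Measurable fun a => V a * H a ^ (q - 1) := hV.mul (hH.pow_const _)
  have f1 : ∀ᵐ a ∂μ, V a * H a ^ (q - 1) < ⊤ :=
    ae_lt_top m1 (h.trans_lt (ENNReal.mul_lt_top hC.lt_top (Ne.lt_top hIt))).ne
  have f2 : ∀ᵐ a ∂μ, H a ^ q < ⊤ := ae_lt_top (hH.pow_const _) hIt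
  calc ∫⁻ a, V a ^ q ∂μ ≤ ∫⁻ a, (V a * H a ^ (q - 1)) ^ q * (H a ^ q) ^ (1 - q) ∂μ := by
        refine lintegral_mono_ae ?_
        filter_upwards [f1, f2] with a h1 h2
        rcases hq1.eq_or_lt with rfl | hq1
        · simp
        by_cases h0 : H a = 0
        · have : V a = 0 := by
            by_contra hv
            rw [h0, ENNReal.zero_rpow_of_neg (by linarith), ENNReal.mul_top hv] at h1
            exact lt_irrefl _ h1
          simp [this, hq0]
        · have ht : H a ≠ ⊤ := fun ht => by
            rw [ht, ENNReal.top_rpow_of_pos hq0] at h2; exact lt_irrefl _ h2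
          rw [ENNReal.mul_rpow_of_nonneg _ _ hq0.le, mul_assoc, ← ENNReal.rpow_mul, ← ENNReal.rpow_mul,
            ← ENNReal.rpow_add _ _ h0 ht]
          have : (q - 1) * q + q * (1 - q) = 0 := by ring
          simp [this]
    _ ≤ (∫⁻ a, V a * H a ^ (q - 1) ∂μ) ^ q * I ^ (1 - q) :=
        ENNReal.lintegral_mul_norm_pow_le m1.aemeasurable (hH.pow_const _).aemeasurable hq0.le (by linarith) (by ring)
    _ ≤ (C * I) ^ q * I ^ (1 - q) := by gcongr
    _ = C ^ q * I := by
        rw [ENNReal.mul_rpow_of_nonneg _ _ hq0.le, mul_assoc, ← ENNReal.rpow_add_of_nonneg _ _ hq0.le (by linarith)]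
        simp
    _ ≤ _ := by gcongr; exact le_self_add

set_option maxHeartbeats 1600000 in
theorem tent_abs {X : Type*} [MeasurableSpace X] (μ : Measure X) [SFinite μ] (d : X → X → ℝ)
    (hdm : Measurable fun z : X × X => d z.1 z.2) (hd0 : ∀ a, d a a = 0)
    (hsym : ∀ a b, d b a ≤ 3 / 2 * d a b)
    (htri : ∀ a b c, d a c ≤ 5 / 2 * (d a b + d b c))
    (hpos : ∀ a s, 0 < s → μ {b | d a b < s} ≠ 0) (hfin : ∀ a s, μ {b | d a b < s} ≠ ⊤)
    (D : ℝ≥0∞) (hD0 : D ≠ 0) (hD : D ≠ ⊤)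
    (hdoub : ∀ a s, 0 < s → μ {b | d a b < 32 * s} ≤ D * μ {b | d a b < s})
    {q : ℝ} (hq0 : 0 < q) (hq1 : q ≤ 1) :
    ∃ C : ℝ≥0∞, C ≠ ⊤ ∧ ∀ f : X × ℝ → ℝ≥0∞, Measurable f →
      ∫⁻ a, (∫⁻ s in Ioi (0:ℝ), f (a, s)) ^ q ∂μ ≤
      C * ∫⁻ a, (∫⁻ s in Ioi (0:ℝ), (μ {b | d a b < s})⁻¹ *
        ∫⁻ b in {b | d a b < s}, f (b, s) ∂μ) ^ q ∂μ := by
  obtain ⟨Cq, hCq, h1D⟩ := oneD hq0 hq1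
  refine ⟨(D * (D ^ (1 - q)) * (Cq * D ^ q)) ^ q + 1, ?_, ?_⟩
  · refine ENNReal.add_ne_top.2 ⟨ENNReal.rpow_ne_top_of_nonneg hq0.le ?_, by simp⟩
    have h1 : D ^ (1 - q) ≠ ⊤ := ENNReal.rpow_ne_top_of_nonneg (by linarith) hD
    have h2 : D ^ q ≠ ⊤ := ENNReal.rpow_ne_top_of_nonneg hq0.le hD
    exact ENNReal.mul_ne_top (ENNReal.mul_ne_top hD h1) (ENNReal.mul_ne_top hCq h2)
  intro f hf
  -- notation
  set m : X → ℝ → ℝ≥0∞ := fun a s => μ {b | d a b < s} with hm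
  set χ : X → X → ℝ → ℝ≥0∞ := fun a b s => if d a b < s then 1 else 0 with hχ
  have hmono : ∀ a s t, s ≤ t → m a s ≤ m a t := fun a s t h =>
    measure_mono fun b (hb : d a b < s) => lt_of_lt_of_le hb h
  have hball : ∀ a s, MeasurableSet {b | d a b < s} := fun a s =>
    measurableSet_lt (hdm.comp measurable_prodMk_left) measurable_const
  have hχm : Measurable fun z : (X × ℝ) × X => χ z.1.1 z.2 z.1.2 := by
    refine Measurable.ite ?_ measurable_const measurable_const
    exact measurableSet_lt (hdm.comp ((measurable_fst.comp measurable_fst).prodMk measurable_snd))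
      (measurable_snd.comp measurable_fst)
  have hχi : ∀ a s (g : X → ℝ≥0∞), ∫⁻ b in {b | d a b < s}, g b ∂μ = ∫⁻ b, χ a b s * g b ∂μ := by
    intro a s g
    rw [← lintegral_indicator (hball a s)]
    refine lintegral_congr fun b => ?_
    by_cases h : d a b < s <;> simp [indicator, hχ, h]
  have hmm : Measurable fun z : X × ℝ => m z.1 z.2 := by
    have : ∀ z : X × ℝ, m z.1 z.2 = ∫⁻ b, χ z.1 b z.2 ∂μ := fun z => by
      have := hχi z.1 z.2 (fun _ => 1)
      simpa [hm] using this
    simp_rw [this]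
    exact hχm.lintegral_prod_right'
  set G : X → ℝ → ℝ≥0∞ := fun a s => (m a s)⁻¹ * ∫⁻ b, χ a b s * f (b, s) ∂μ with hG
  set g : X → ℝ → ℝ≥0∞ := fun a s => (m a (s/10))⁻¹ * ∫⁻ b, χ a b (s/10) * f (b, s) ∂μ with hg
  have hGm : Measurable fun z : X × ℝ => G z.1 z.2 := by
    refine hmm.inv.mul (Measurable.lintegral_prod_right' (f := fun w : (X × ℝ) × X => χ w.1.1 w.2 w.1.2 * f (w.2, w.1.2)) ?_)
    exact hχm.mul (hf.comp (by fun_prop))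
  have hχm' : Measurable fun z : (X × ℝ) × X => χ z.1.1 z.2 (z.1.2/10) :=
    hχm.comp (f := fun z : (X × ℝ) × X => ((z.1.1, z.1.2/10), z.2)) (by fun_prop)
  have hmm' : Measurable fun z : X × ℝ => m z.1 (z.2/10) :=
    hmm.comp (f := fun z : X × ℝ => (z.1, z.2/10)) (by fun_prop)
  have hgm : Measurable fun z : X × ℝ => g z.1 z.2 := by
    refine hmm'.inv.mul (Measurable.lintegral_prod_right' (f := fun w : (X × ℝ) × X => χ w.1.1 w.2 (w.1.2/10) * f (w.2, w.1.2)) ?_)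
    exact hχm'.mul (hf.comp (by fun_prop))
  set H : X → ℝ≥0∞ := fun a => ∫⁻ s in Ioi (0:ℝ), G a s with hH
  have hHm : Measurable H := hGm.lintegral_prod_right'
  set V : X → ℝ≥0∞ := fun a => ∫⁻ s in Ioi (0:ℝ), f (a, s) with hV
  have hVm : Measurable V := hf.lintegral_prod_right'
  set Φ : X → ℝ → ℝ≥0∞ := fun a s => ∫⁻ u in Ici s, g a u with hΦ
  have hΦm : Measurable fun z : X × ℝ => Φ z.1 z.2 := by
    have : ∀ z : X × ℝ, Φ z.1 z.2 = ∫⁻ u, (if z.2 ≤ u then 1 else 0) * g z.1 u := fun z => by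
      simp only [hΦ]
      rw [← lintegral_indicator measurableSet_Ici]
      refine lintegral_congr fun b => ?_
      by_cases h : z.2 ≤ b <;> simp [indicator, h]
    simp_rw [this]
    refine Measurable.lintegral_prod_right' (f := fun w : (X × ℝ) × ℝ => (if w.1.2 ≤ w.2 then 1 else 0) * g w.1.1 w.2) ?_
    refine (Measurable.ite (measurableSet_le (by fun_prop) (by fun_prop)) measurable_const measurable_const).mul ?_
    exact hgm.comp (f := fun w : (X × ℝ) × ℝ => (w.1.1, w.2)) (by fun_prop)
  -- geometric comparison
  have hgG : ∀ a b s, 0 < s → d a b < s / 10 → g a s ≤ D * G b s := by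
    intro a b s hs hab
    have hba := hsym a b
    have i1 : m b s ≤ D * m a (s/10) := by
      refine le_trans ?_ (hdoub a (s/10) (by positivity))
      refine measure_mono fun z (hz : d b z < s) => ?_
      have := htri a b z
      show d a z < 32 * (s / 10)
      linarith
    have i2 : ∀ z, χ a z (s/10) ≤ χ b z s := fun z => by
      by_cases h : d a z < s / 10
      · have := htri b a z
        have : d b z < s := by linarith
        simp [hχ, h, this]
      · simp [hχ, h]
    have i3 : (m a (s/10))⁻¹ ≤ D * (m b s)⁻¹ := by
      rw [← div_eq_mul_inv, ENNReal.le_div_iff_mul_le (Or.inl (hpos b s hs)) (Or.inl (hfin b s)), mul_comm,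
        ← div_eq_mul_inv]
      exact ENNReal.div_le_of_le_mul i1
    simp only [hg, hG]
    rw [← mul_assoc]
    gcongr with z
    exact i2 z
  have hΦH : ∀ a b s, 0 < s → d a b < s / 10 → Φ a s ≤ D * H b := by
    intro a b s hs hab
    rw [hH, ← lintegral_const_mul' _ _ hD]
    refine le_trans ?_ (lintegral_mono_set (Ici_subset_Ioi.2 hs))
    refine setLIntegral_mono' measurableSet_Ici fun u (hu : s ≤ u) => hgG a b u (by linarith) (by linarith)
  have hΦ0 : ∀ a, ∫⁻ s in Ioi (0:ℝ), g a s ≤ D * H a := by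
    intro a
    rw [hH, ← lintegral_const_mul' _ _ hD]
    refine setLIntegral_mono' measurableSet_Ioi fun u (hu : 0 < u) => hgG a a u hu (by rw [hd0]; positivity)
  have hone : ∀ b s, 0 < s → 1 ≤ D * ∫⁻ a, χ a b (s/10) * (m a (s/10))⁻¹ ∂μ := by
    intro b s hs
    have j1 : ∀ a, χ b a (s/15) * (m b (32 * (s/15)))⁻¹ ≤ χ a b (s/10) * (m a (s/10))⁻¹ := by
      intro a
      by_cases h : d b a < s / 15
      · have h2 := hsym b a
        have h3 : d a b < s / 10 := by linarith
        simp only [hχ, h, h3, if_true, one_mul]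
        refine ENNReal.inv_le_inv.2 (measure_mono fun z (hz : d a z < s / 10) => ?_)
        have := htri b a z
        show d b z < 32 * (s/15)
        linarith
      · simp [hχ, h]
    have j2 : ∫⁻ a, χ b a (s/15) ∂μ = m b (s/15) := by
      have := hχi b (s/15) (fun _ => 1)
      simpa [hm] using this.symm
    have hs' : 0 < s / 15 := by positivity
    calc (1:ℝ≥0∞) = m b (32 * (s/15)) * (m b (32 * (s/15)))⁻¹ :=
          (ENNReal.mul_inv_cancel (hpos b _ (by positivity)) (hfin b _)).symm
      _ ≤ D * m b (s/15) * (m b (32 * (s/15)))⁻¹ := by gcongr; exact hdoub b _ hs'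
      _ = D * ∫⁻ a, χ b a (s/15) * (m b (32 * (s/15)))⁻¹ ∂μ := by
          rw [lintegral_mul_const' _ _ (ENNReal.inv_ne_top.2 (hpos b _ (by positivity))), j2, mul_assoc]
      _ ≤ _ := mul_le_mul_right (lintegral_mono j1) D
  -- the powers
  have hpow : ∀ a b s, 0 < s → d a b < s / 10 → H b ^ (q - 1) ≤ D ^ (1 - q) * Φ a s ^ (q - 1) := by
    intro a b s hs hab
    have h1 := rpow_anti (z := q - 1) (by linarith) (hΦH a b s hs hab)
    calc H b ^ (q - 1) = D ^ (1 - q) * (D * H b) ^ (q - 1) := by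
          by_cases hHt : H b = ⊤
          · rcases hq1.eq_or_lt with rfl | hq
            · simp
            rw [hHt, ENNReal.mul_top hD0, ENNReal.top_rpow_of_neg (by linarith)]; simp
          rw [ENNReal.mul_rpow_of_ne_top hD hHt, ← mul_assoc, ← ENNReal.rpow_add _ _ hD0 hD]
          simp
      _ ≤ _ := by gcongr
  set K : X → X → ℝ → ℝ≥0∞ := fun a b s =>
    χ a b (s/10) * (m a (s/10))⁻¹ * Φ a s ^ (q - 1) * f (b, s) with hK
  have hKm : Measurable fun z : (X × ℝ) × X => K z.1.1 z.2 z.1.2 := by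
    refine ((hχm'.mul (hmm'.inv.comp measurable_fst)).mul ((hΦm.pow_const _).comp measurable_fst)).mul ?_
    exact hf.comp (by fun_prop)
  have main : ∫⁻ a, V a * H a ^ (q - 1) ∂μ ≤ D * (D ^ (1 - q)) * (Cq * D ^ q) * ∫⁻ a, H a ^ q ∂μ := by
    have hD1 : D ^ (1 - q) ≠ ⊤ := ENNReal.rpow_ne_top_of_nonneg (by linarith) hD
    calc ∫⁻ b, V b * H b ^ (q - 1) ∂μ = ∫⁻ b, (∫⁻ s in Ioi (0:ℝ), f (b, s) * H b ^ (q - 1)) ∂μ := by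
          refine lintegral_congr fun b => ?_
          exact (lintegral_mul_const _ (hf.comp measurable_prodMk_left)).symm
      _ ≤ ∫⁻ b, (∫⁻ s in Ioi (0:ℝ), (D * D ^ (1 - q)) * ∫⁻ a, K a b s ∂μ) ∂μ := by
          refine lintegral_mono fun b => setLIntegral_mono' measurableSet_Ioi fun s (hs : 0 < s) => ?_
          calc f (b, s) * H b ^ (q - 1) ≤ f (b, s) * H b ^ (q - 1) * (D * ∫⁻ a, χ a b (s/10) * (m a (s/10))⁻¹ ∂μ) :=
                le_mul_of_one_le_right' (hone b s hs)
            _ = D * ((f (b, s) * H b ^ (q - 1)) * ∫⁻ a, χ a b (s/10) * (m a (s/10))⁻¹ ∂μ) := by ring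
            _ = D * ∫⁻ a, (f (b, s) * H b ^ (q - 1)) * (χ a b (s/10) * (m a (s/10))⁻¹) ∂μ := by
                rw [lintegral_const_mul]
                have : Measurable fun z : X × ℝ => χ z.1 b (z.2/10) := 
                  hχm'.comp (f := fun z : X × ℝ => (z, b)) (by fun_prop)
                exact (this.mul hmm'.inv).comp (f := fun a : X => (a, s)) (by fun_prop)
            _ ≤ D * ∫⁻ a, D ^ (1 - q) * K a b s ∂μ := by
                refine mul_le_mul_right (lintegral_mono fun a => ?_) D
                by_cases h : d a b < s / 10
                · calc _ ≤ (f (b, s) * (D ^ (1 - q) * Φ a s ^ (q - 1))) * (χ a b (s/10) * (m a (s/10))⁻¹) := by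
                        exact mul_le_mul_left (mul_le_mul_right (hpow a b s hs h) _) _
                    _ = _ := by simp only [hK]; ring
                · simp [hχ, h]
            _ = _ := by rw [lintegral_const_mul' _ _ hD1, mul_assoc]
      _ = (D * D ^ (1 - q)) * ∫⁻ b, (∫⁻ s in Ioi (0:ℝ), ∫⁻ a, K a b s ∂μ) ∂μ := by
          simp_rw [lintegral_const_mul' _ _ (ENNReal.mul_ne_top hD hD1)]
      _ = (D * D ^ (1 - q)) * ∫⁻ a, (∫⁻ s in Ioi (0:ℝ), ∫⁻ b, K a b s ∂μ) ∂μ := by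
          congr 1
          have s1 : ∀ b, ∫⁻ s in Ioi (0:ℝ), ∫⁻ a, K a b s ∂μ = ∫⁻ a, (∫⁻ s in Ioi (0:ℝ), K a b s) ∂μ := fun b => by
            refine lintegral_lintegral_swap (f := fun s a => K a b s) ?_
            exact (hKm.comp (f := fun z : ℝ × X => ((z.2, z.1), b)) (by fun_prop)).aemeasurable
          simp_rw [s1]
          rw [lintegral_lintegral_swap]
          · refine lintegral_congr fun a => ?_
            refine lintegral_lintegral_swap (f := fun b s => K a b s) ?_
            exact (hKm.comp (f := fun z : X × ℝ => ((a, z.2), z.1)) (by fun_prop)).aemeasurable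
          · refine Measurable.aemeasurable (Measurable.lintegral_prod_right' (f := fun w : (X × X) × ℝ => K w.1.2 w.1.1 w.2) ?_)
            exact hKm.comp (f := fun w : (X × X) × ℝ => ((w.1.2, w.2), w.1.1)) (by fun_prop)
      _ = (D * D ^ (1 - q)) * ∫⁻ a, (∫⁻ s in Ioi (0:ℝ), g a s * Φ a s ^ (q - 1)) ∂μ := by
          congr 1
          refine lintegral_congr fun a => lintegral_congr fun s => ?_
          have : ∀ b, K a b s = ((m a (s/10))⁻¹ * Φ a s ^ (q - 1)) * (χ a b (s/10) * f (b, s)) := fun b => by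
            simp only [hK]; ring
          simp_rw [this]
          rw [lintegral_const_mul]
          · simp only [hg]; ring
          · exact (hχm'.comp (f := fun b : X => ((a, s), b)) (by fun_prop)).mul (hf.comp (by fun_prop))
      _ ≤ (D * D ^ (1 - q)) * ∫⁻ a, Cq * (D ^ q * H a ^ q) ∂μ := by
          refine mul_le_mul_right (lintegral_mono fun a => ?_) _
          refine (h1D (g a) (hgm.comp measurable_prodMk_left)).trans ?_
          rw [← ENNReal.mul_rpow_of_nonneg _ _ hq0.le]
          gcongr
          exact hΦ0 a
      _ = _ := by
          rw [lintegral_const_mul' _ _ hCq, lintegral_const_mul' _ _ (ENNReal.rpow_ne_top_of_nonneg hq0.le hD)]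
          ring
  have fin := holder_fin μ hq0 hq1 V H hVm hHm _ ?_ main
  · refine fin.trans (le_of_eq ?_)
    simp only [hH, hG, hχi]
    rfl
  · have h1 : D ^ (1 - q) ≠ ⊤ := ENNReal.rpow_ne_top_of_nonneg (by linarith) hD
    have h2 : D ^ q ≠ ⊤ := ENNReal.rpow_ne_top_of_nonneg hq0.le hD
    exact ENNReal.mul_ne_top (ENNReal.mul_ne_top hD h1) (ENNReal.mul_ne_top hCq h2)

def rho2 {n : ℕ} (a b : CoSph n) : ℝ :=
  abs (inner (𝕜 := ℝ) ((a.2 : En n)) (a.1 - b.1)) + ‖a.1 - b.1‖ ^ 2 +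
    ‖(a.2 : En n) - (b.2 : En n)‖ ^ 2

lemma rball_eq {n : ℕ} (a : CoSph n) {s : ℝ} (hs : 0 < s) : rball a (Real.sqrt s) = {b | rho2 a b < s} := by
  ext b
  simp only [rball, rho, mem_ofPred_eq]
  rw [Real.sqrt_lt_sqrt_iff_of_pos hs]; rfl

lemma rho2_meas {n : ℕ} : Measurable fun z : CoSph n × CoSph n => rho2 z.1 z.2 := by
  unfold rho2
  refine Continuous.measurable ?_
  fun_prop

lemma rho2_self {n : ℕ} (a : CoSph n) : rho2 a a = 0 := by simp [rho2]

lemma rho2_symm {n : ℕ} (a b : CoSph n) : rho2 b a ≤ 3 / 2 * rho2 a b := by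
  obtain ⟨x, ω⟩ := a
  obtain ⟨y, ν⟩ := b
  simp only [rho2]
  rw [norm_sub_rev y x, norm_sub_rev (ν : En n) ω]
  have h1 : inner ℝ (ν : En n) (y - x) = - inner ℝ (ω : En n) (x - y) + inner ℝ ((ω : En n) - ν) (x - y) := by
    rw [← neg_sub x y, inner_neg_right, inner_sub_left]; ring
  have h2 := abs_real_inner_le_norm ((ω : En n) - ν) (x - y)
  have h3 : |inner ℝ (ν : En n) (y - x)| ≤ |inner ℝ (ω : En n) (x - y)| + ‖(ω : En n) - ν‖ * ‖x - y‖ := by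
    rw [h1]; refine (abs_add_le _ _).trans ?_
    rw [abs_neg]; linarith
  nlinarith [sq_nonneg (‖(ω : En n) - ν‖ - ‖x - y‖), abs_nonneg (inner ℝ (ω : En n) (x - y))]

lemma rho2_tri {n : ℕ} (a b c : CoSph n) : rho2 a c ≤ 5 / 2 * (rho2 a b + rho2 b c) := by
  obtain ⟨x, ω⟩ := a
  obtain ⟨y, ν⟩ := b
  obtain ⟨z, η⟩ := c
  simp only [rho2]
  have h1 : inner ℝ (ω : En n) (x - z) = inner ℝ (ω : En n) (x - y) + inner ℝ (ν : En n) (y - z)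
      + inner ℝ ((ω : En n) - ν) (y - z) := by
    simp only [inner_sub_left, inner_sub_right]; ring
  have h2 := abs_real_inner_le_norm ((ω : En n) - ν) (y - z)
  have h3 : |inner ℝ (ω : En n) (x - z)| ≤ |inner ℝ (ω : En n) (x - y)| + |inner ℝ (ν : En n) (y - z)|
      + ‖(ω : En n) - ν‖ * ‖y - z‖ := by
    rw [h1]; refine (abs_add_three _ _ _).trans ?_
    linarith
  have h4 : ‖x - z‖ ≤ ‖x - y‖ + ‖y - z‖ := norm_sub_le_norm_sub_add_norm_sub _ _ _
  have h5 : ‖(ω : En n) - η‖ ≤ ‖(ω : En n) - ν‖ + ‖(ν : En n) - η‖ := norm_sub_le_norm_sub_add_norm_sub _ _ _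
  have h6 : ‖x - z‖ ^ 2 ≤ 2 * (‖x - y‖ ^ 2 + ‖y - z‖ ^ 2) := by
    nlinarith [sq_nonneg (‖x - y‖ - ‖y - z‖), norm_nonneg (x - z)]
  have h7 : ‖(ω : En n) - η‖ ^ 2 ≤ 2 * (‖(ω : En n) - ν‖ ^ 2 + ‖(ν : En n) - η‖ ^ 2) := by
    nlinarith [sq_nonneg (‖(ω : En n) - ν‖ - ‖(ν : En n) - η‖), norm_nonneg ((ω : En n) - η)]
  nlinarith [sq_nonneg (‖(ω : En n) - ν‖ - ‖y - z‖), abs_nonneg (inner ℝ (ω : En n) (x - y)),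
    abs_nonneg (inner ℝ (ν : En n) (y - z)), sq_nonneg ‖x - y‖, sq_nonneg ‖(ν : En n) - η‖]

def slab {n : ℕ} (a : CoSph n) (s : ℝ) : Set (En n) :=
  {y | |inner ℝ (a.2 : En n) (a.1 - y)| < s ∧ ‖a.1 - y‖ ^ 2 < s}
def cap {n : ℕ} (ω : Sph n) (r : ℝ) : Set (Sph n) := {ν | ‖(ω : En n) - ν‖ < r}

lemma rhoball_sub {n : ℕ} (a : CoSph n) {s : ℝ} : {b | rho2 a b < s} ⊆ slab a s ×ˢ cap a.2 (Real.sqrt s) := by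
  intro b (hb : rho2 a b < s)
  unfold rho2 at hb
  have h1 := abs_nonneg (inner ℝ (a.2 : En n) (a.1 - b.1))
  have h2 := sq_nonneg ‖a.1 - b.1‖
  have h3 := sq_nonneg ‖(a.2 : En n) - b.2‖
  refine ⟨⟨by linarith, by linarith⟩, ?_⟩
  exact Real.lt_sqrt_of_sq_lt (by linarith)

lemma sub_rhoball {n : ℕ} (a : CoSph n) {s : ℝ} (hs : 0 < s) :
    slab a (s / 3) ×ˢ cap a.2 (Real.sqrt (s / 3)) ⊆ {b | rho2 a b < s} := by
  rintro b ⟨⟨h1, h2⟩, h3⟩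
  have h3 : ‖(a.2 : En n) - b.2‖ < Real.sqrt (s/3) := h3
  have h4 := (Real.lt_sqrt (norm_nonneg _)).1 h3
  show _ + _ + _ < s
  linarith

lemma slab_open {n : ℕ} (a : CoSph n) (s : ℝ) : IsOpen (slab a s) := by
  have e : slab a s = {y | |inner ℝ (a.2 : En n) (a.1 - y)| < s} ∩ {y | ‖a.1 - y‖ ^ 2 < s} := rfl
  rw [e]
  exact (isOpen_lt (by fun_prop) continuous_const).inter (isOpen_lt (by fun_prop) continuous_const)

lemma cap_open {n : ℕ} (a : Sph n) (s : ℝ) : IsOpen (cap a s) := by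
  refine (isOpen_lt ?_ continuous_const); fun_prop

lemma slab_pos {n : ℕ} (a : CoSph n) {s : ℝ} (hs : 0 < s) : volume (slab a s) ≠ 0 :=
  ((slab_open a s).measure_pos volume ⟨a.1, by simp [slab, hs]⟩).ne'

lemma slab_fin {n : ℕ} (a : CoSph n) (s : ℝ) : volume (slab a s) ≠ ⊤ := by
  refine (lt_of_le_of_lt (measure_mono (t := Metric.ball a.1 (Real.sqrt s)) ?_) measure_ball_lt_top).ne
  intro y hy
  rw [mem_ball, dist_comm, dist_eq_norm]
  exact Real.lt_sqrt_of_sq_lt hy.2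

lemma slab_doub {n : ℕ} (a : CoSph n) {s : ℝ} (hs : 0 < s) :
    volume (slab a (96 * s)) ≤ ENNReal.ofReal (96 ^ n) * volume (slab a s) := by
  have h : slab a (96 * s) ⊆ AffineMap.homothety a.1 (96:ℝ) '' slab a s := by
    intro y hy
    refine ⟨AffineMap.homothety a.1 (96⁻¹:ℝ) y, ?_, ?_⟩
    · have e : a.1 - AffineMap.homothety a.1 (96⁻¹:ℝ) y = (96⁻¹:ℝ) • (a.1 - y) := by
        simp [AffineMap.homothety_apply, smul_sub]
      obtain ⟨h1, h2⟩ := hy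
      constructor
      · rw [e, inner_smul_right, abs_mul]
        norm_num; linarith
      · rw [e, norm_smul, mul_pow]
        norm_num; nlinarith
    · simp [AffineMap.homothety_apply, smul_smul]
  refine (measure_mono h).trans ?_
  rw [Measure.addHaar_image_homothety]
  simp

instance sph_fin (n : ℕ) : IsFiniteMeasure (sphMeasure n) := by
  unfold sphMeasure
  by_cases h : (volume : Measure (En n)).toSphere univ = 0
  · have : (volume : Measure (En n)).toSphere = 0 := Measure.measure_univ_eq_zero.1 h
    rw [this, smul_zero]; infer_instance
  · exact ⟨ENNReal.mul_lt_top (ENNReal.inv_lt_top.2 (pos_iff_ne_zero.2 h)) (measure_lt_top _ _)⟩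

lemma cap_pos {n : ℕ} (ω : Sph n) {r : ℝ} (hr : 0 < r) : sphMeasure n (cap ω r) ≠ 0 := by
  have := ((cap_open ω r).measure_pos (volume : Measure (En n)).toSphere ⟨ω, by simp [cap, hr]⟩).ne'
  exact mul_ne_zero (ENNReal.inv_ne_zero.2 (measure_ne_top _ _)) this

open scoped Pointwise in
lemma sph_inv {n : ℕ} (ω ν : Sph n) (r : ℝ) : sphMeasure n (cap ω r) = sphMeasure n (cap ν r) := by
  obtain ⟨R, hR⟩ : ∃ R : En n ≃ₗᵢ[ℝ] En n, R ω = ν := by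
    refine ⟨(Submodule.span ℝ {(ω : En n) - ν})ᗮ.reflection, Submodule.reflection_sub ?_⟩
    simp
  have e : Ioo (0:ℝ) 1 • ((↑) '' (cap ω r) : Set (En n)) = R ⁻¹' (Ioo (0:ℝ) 1 • ((↑) '' (cap ν r) : Set (En n))) := by
    ext u
    simp only [mem_preimage, Set.mem_smul]
    constructor
    · rintro ⟨t, ht, _, ⟨η, hη, rfl⟩, rfl⟩
      refine ⟨t, ht, R η, ⟨⟨R η, by simp⟩, ?_, rfl⟩, by simp⟩
      show ‖(ν : En n) - R η‖ < r
      rw [← hR, ← map_sub, R.norm_map]; exact hη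
    · rintro ⟨t, ht, _, ⟨η, hη, rfl⟩, h⟩
      refine ⟨t, ht, R.symm η, ⟨⟨R.symm η, by simp⟩, ?_, rfl⟩, ?_⟩
      · show ‖(ω : En n) - R.symm η‖ < r
        rw [← R.norm_map, map_sub, hR, R.apply_symm_apply]; exact hη
      · apply R.injective; simp [h]
  have : (volume : Measure (En n)).toSphere (cap ω r) = (volume : Measure (En n)).toSphere (cap ν r) := by
    rw [Measure.toSphere_apply' _ (cap_open _ _).measurableSet, Measure.toSphere_apply' _ (cap_open _ _).measurableSet, e,
      R.measurePreserving.measure_preimage_emb R.toHomeomorph.measurableEmbedding]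
  simp [sphMeasure, this]

lemma cap_doub2 {n : ℕ} (ω : Sph n) {r : ℝ} (hr : 0 < r) :
    sphMeasure n (cap ω (2 * r)) ≤ 5 ^ n * sphMeasure n (cap ω r) := by
  classical
  let P : Finset (Sph n) → Prop := fun S => (∀ c ∈ S, c ∈ cap ω (2 * r)) ∧
    ∀ c ∈ S, ∀ d ∈ S, c ≠ d → r ≤ ‖(c : En n) - d‖
  have hcard : ∀ S, P S → S.card ≤ 5 ^ n := by
    intro S hS
    let φ : Sph n → En n := fun c => r⁻¹ • ((ω : En n) - c)
    have hφ : Function.Injective φ := fun c d h => by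
      have := smul_right_injective (En n) (inv_ne_zero hr.ne') h
      exact Subtype.ext (sub_right_injective this)
    have := Besicovitch.card_le_of_separated (E := En n) (S.image φ) ?_ ?_
    · rwa [Finset.card_image_of_injective _ hφ, finrank_euclideanSpace_fin] at this
    · intro c hc
      obtain ⟨c, hc', rfl⟩ := Finset.mem_image.1 hc
      have : ‖(ω : En n) - c‖ < 2 * r := hS.1 c hc'
      simp only [φ, norm_smul, norm_inv, Real.norm_eq_abs, abs_of_pos hr]
      rw [inv_mul_le_iff₀ hr]; linarith
    · intro c hc d hd hcd
      obtain ⟨c, hc', rfl⟩ := Finset.mem_image.1 hc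
      obtain ⟨d, hd', rfl⟩ := Finset.mem_image.1 hd
      have := hS.2 c hc' d hd' (fun h => hcd (by rw [h]))
      have e : φ c - φ d = r⁻¹ • ((d : En n) - c) := by simp only [φ, ← smul_sub]; congr 1; abel
      rw [e, norm_smul, norm_inv, Real.norm_eq_abs, abs_of_pos hr, norm_sub_rev, le_inv_mul_iff₀ hr]
      linarith
  obtain ⟨S, hS, hmax⟩ : ∃ S, P S ∧ ∀ T, P T → T.card ≤ S.card := by
    have hb : BddAbove (Finset.card '' {S | P S}) := ⟨5 ^ n, by rintro _ ⟨S, hS, rfl⟩; exact hcard S hS⟩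
    have hne : (Finset.card '' {S | P S}).Nonempty := ⟨0, ∅, by simp [P], by simp⟩
    obtain ⟨S, hS, h⟩ := Nat.sSup_mem hne hb
    exact ⟨S, hS, fun T hT => by rw [h]; exact le_csSup hb ⟨T, hT, rfl⟩⟩
  have hcov : cap ω (2 * r) ⊆ ⋃ c ∈ S, cap c r := by
    intro ν hν
    by_contra hcon
    simp only [mem_iUnion, not_exists] at hcon
    have hfar : ∀ c ∈ S, r ≤ ‖(c : En n) - ν‖ := fun c hc => not_lt.1 (hcon c hc)
    have hνS : ν ∉ S := fun h => by
      have := hfar ν h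
      simp at this; linarith
    have := hmax (insert ν S) ⟨?_, ?_⟩
    · rw [Finset.card_insert_of_notMem hνS] at this; omega
    · intro c hc
      rcases Finset.mem_insert.1 hc with rfl | hc
      · exact hν
      · exact hS.1 c hc
    · intro c hc d hd hcd
      rcases Finset.mem_insert.1 hc with hc | hc <;> rcases Finset.mem_insert.1 hd with hd | hd
      · exact absurd (hc.trans hd.symm) hcd
      · rw [hc, norm_sub_rev]; exact hfar d hd
      · rw [hd]; exact hfar c hc
      · exact hS.2 c hc d hd hcd
  calc _ ≤ sphMeasure n (⋃ c ∈ S, cap c r) := measure_mono hcov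
    _ ≤ ∑ c ∈ S, sphMeasure n (cap c r) := measure_biUnion_finset_le _ _
    _ = S.card * sphMeasure n (cap ω r) := by
        rw [Finset.sum_congr rfl (fun c _ => sph_inv c ω r)]; simp
    _ ≤ _ := by gcongr; exact_mod_cast hcard S hS

lemma cap_doub {n : ℕ} (ω : Sph n) {s : ℝ} (hs : 0 < s) :
    sphMeasure n (cap ω (Real.sqrt (96 * s))) ≤ (5 ^ n) ^ 4 * sphMeasure n (cap ω (Real.sqrt s)) := by
  have hr := Real.sqrt_pos.2 hs
  have h : Real.sqrt (96 * s) ≤ 2 * (2 * (2 * (2 * Real.sqrt s))) := by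
    rw [Real.sqrt_le_left (by positivity)]
    nlinarith [Real.sq_sqrt hs.le]
  calc _ ≤ sphMeasure n (cap ω (2 * (2 * (2 * (2 * Real.sqrt s))))) :=
        measure_mono fun ν (hν : _ < _) => lt_of_lt_of_le hν h
    _ ≤ 5 ^ n * (5 ^ n * (5 ^ n * (5 ^ n * sphMeasure n (cap ω (Real.sqrt s))))) := by
        refine (cap_doub2 ω (by positivity)).trans ?_
        gcongr
        refine (cap_doub2 ω (by positivity)).trans ?_
        gcongr
        refine (cap_doub2 ω (by positivity)).trans ?_
        gcongr
        exact cap_doub2 ω (by positivity)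
    _ = _ := by ring

instance muS_sf (n : ℕ) : SFinite (muS n) := by unfold muS; infer_instance

lemma mu_pos {n : ℕ} (a : CoSph n) (s : ℝ) (hs : 0 < s) : muS n {b | rho2 a b < s} ≠ 0 := by
  intro h
  have := measure_mono_null (sub_rhoball a hs) h
  rw [muS, Measure.prod_prod, mul_eq_zero] at this
  exact this.elim (slab_pos a (by positivity)) (cap_pos a.2 (Real.sqrt_pos.2 (by positivity)))

lemma mu_fin {n : ℕ} (a : CoSph n) (s : ℝ) : muS n {b | rho2 a b < s} ≠ ⊤ := by
  refine (lt_of_le_of_lt (measure_mono (rhoball_sub a)) ?_).ne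
  rw [muS, Measure.prod_prod]
  exact ENNReal.mul_lt_top (slab_fin a s).lt_top (measure_lt_top _ _)

lemma mu_doub {n : ℕ} (a : CoSph n) (s : ℝ) (hs : 0 < s) : muS n {b | rho2 a b < 32 * s} ≤
    (ENNReal.ofReal (96 ^ n) * (5 ^ n) ^ 4) * muS n {b | rho2 a b < s} := by
  have e : 32 * s = 96 * (s / 3) := by ring
  calc _ ≤ muS n (slab a (32 * s) ×ˢ cap a.2 (Real.sqrt (32 * s))) := measure_mono (rhoball_sub a)
    _ = volume (slab a (96 * (s/3))) * sphMeasure n (cap a.2 (Real.sqrt (96 * (s/3)))) := by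
        rw [muS, Measure.prod_prod, e]
    _ ≤ (ENNReal.ofReal (96 ^ n) * volume (slab a (s/3))) * ((5 ^ n) ^ 4 * sphMeasure n (cap a.2 (Real.sqrt (s/3)))) := by
        gcongr
        · exact slab_doub a (by positivity)
        · exact cap_doub a.2 (by positivity)
    _ = (ENNReal.ofReal (96 ^ n) * (5 ^ n) ^ 4) * muS n (slab a (s/3) ×ˢ cap a.2 (Real.sqrt (s/3))) := by
        rw [muS, Measure.prod_prod]; ring
    _ ≤ _ := by gcongr; exact sub_rhoball a hs

/-- For 0 < p ≤ 2, the vertical square function is dominated in L^p(S*)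
by the conical one: (∫ (∫₀^∞ |F(x,ω,σ)|² dσ/σ)^{p/2} dx dω)^{1/p} ≤ C ‖A F‖_{L^p(S*)}. -/
theorem vertical_le_conical (n : ℕ) (hn : 2 ≤ n) (p : ℝ) (hp0 : 0 < p) (hp2 : p ≤ 2) :
    ∃ C : ℝ≥0∞, C < ⊤ ∧
      ∀ F : CoSph n × ℝ → ℂ, Measurable F →
        (∫⁻ a, (∫⁻ σ in Set.Ioi (0 : ℝ),
              (‖F (a, σ)‖₊ : ℝ≥0∞) ^ (2 : ℝ) * ENNReal.ofReal σ⁻¹) ^ (p / 2)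
            ∂(muS n)) ^ (1 / p) ≤
          C * (∫⁻ a, conSF F a ^ p ∂(muS n)) ^ (1 / p) := by
  have hp : 0 ≤ 1 / p := by positivity
  obtain ⟨C, hC, h⟩ := tent_abs (muS n) rho2 rho2_meas rho2_self rho2_symm rho2_tri mu_pos mu_fin
    (ENNReal.ofReal (96 ^ n) * (5 ^ n) ^ 4)
    (mul_ne_zero (by simp) (by simp)) (ENNReal.mul_ne_top (by simp) (by simp)) mu_doub
    (q := p / 2) (by positivity) (by linarith)
  refine ⟨C ^ (1 / p), ENNReal.rpow_lt_top_of_nonneg hp hC, fun F hF => ?_⟩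
  have := h (fun z => (‖F z‖₊ : ℝ≥0∞) ^ (2 : ℝ) * ENNReal.ofReal z.2⁻¹) (by fun_prop)
  rw [← ENNReal.mul_rpow_of_nonneg _ _ hp]
  refine ENNReal.rpow_le_rpow (this.trans (le_of_eq ?_)) hp
  congr 1
  refine lintegral_congr fun a => ?_
  rw [conSF, ← ENNReal.rpow_mul, one_div_mul_eq_div]
  congr 1
  refine setLIntegral_congr_fun measurableSet_Ioi fun s (hs : 0 < s) => ?_
  simp only
  rw [lintegral_mul_const' _ _ ENNReal.ofReal_ne_top, rball_eq a hs, mul_assoc]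
end
end
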